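/- arXiv:quant-ph/0410047 — 3 statements merged into one kernel-verified Lean document; each statement's English description precedes it below -/
import Mathlib

section
/- Let $r \ge 1$, $k \ge 1$, and $A \ge k+1$ be integers, write $B = \binom{A}{k+1}$, and let $\gamma_0$ be a real number with $0 < \gamma_0 < (rB)^{-1/k}$. Let $P : \mathbb{N} \to \mathbb{R}$ be any sequence satisfying $P(0) \ge 1 - \gamma_0$, $P(n) \le 1$ for all $n$, and the recursive inequality $P(n+1) \ge \big(1 - B\,(1-P(n))^{k+1}\big)^r$ for all $n \ge 0$. Then there exists $\delta > 0$ such that for every $n \ge 1$, $P(n) > 1 - \gamma_0^{(1+\delta)^n}$. -/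
open Real

/-- Lemma 1 of the paper: below the critical failure probability
`(r * B)^(-1/k)` with `B = choose A (k+1)`, any sequence `P` satisfying the
recursive sparseness inequality satisfies
`P n > 1 - γ₀ ^ ((1+δ)^n)` for some `δ > 0` and all `n ≥ 1`. -/
theorem local_threshold_lemma
    (r k A : ℕ) (hr : 1 ≤ r) (hk : 1 ≤ k) (hA : k + 1 ≤ A)
    (γ0 : ℝ) (hγ0 : 0 < γ0)
    (hthr : γ0 < ((r * A.choose (k + 1) : ℕ) : ℝ) ^ (-(1 / (k : ℝ))))
    (P : ℕ → ℝ)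
    (hP0 : 1 - γ0 ≤ P 0)
    (hP1 : ∀ n, P n ≤ 1)
    (hrec : ∀ n, (1 - (A.choose (k + 1) : ℝ) * (1 - P n) ^ (k + 1)) ^ r ≤ P (n + 1)) :
    ∃ δ : ℝ, 0 < δ ∧ ∀ n : ℕ, 1 ≤ n → P n > 1 - γ0 ^ (((1 + δ) ^ n : ℝ)) := by
  have hB : 1 ≤ A.choose (k + 1) := Nat.choose_pos hA
  have hC : (1:ℝ) ≤ ((r * A.choose (k + 1) : ℕ) : ℝ) := by
    exact_mod_cast Nat.mul_pos hr hB
  have hr' : (1:ℝ) ≤ r := by exact_mod_cast hr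
  have hk' : (1:ℝ) ≤ k := by exact_mod_cast hk
  have hB' : (1:ℝ) ≤ (A.choose (k + 1) : ℝ) := by exact_mod_cast hB
  have hCe : ((r * A.choose (k + 1) : ℕ) : ℝ) = r * (A.choose (k + 1) : ℝ) := by push_cast; ring
  generalize (A.choose (k + 1) : ℝ) = B at *
  generalize ((r * A.choose (k + 1) : ℕ) : ℝ) = C at *
  have hC0 : 0 < C := by linarith
  have hγk : γ0 ^ k < C⁻¹ := by
    have h := pow_lt_pow_left₀ hthr hγ0.le (by omega : k ≠ 0)
    rwa [← Real.rpow_natCast (C ^ _), ← Real.rpow_mul hC0.le,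
      show -(1 / (k:ℝ)) * k = -1 by field_simp, Real.rpow_neg_one] at h
  have hγ1 : γ0 < 1 := by
    by_contra hcon
    push Not at hcon
    have h1 := one_le_pow₀ hcon (n := k)
    have h2 := inv_le_one_of_one_le₀ hC
    linarith
  obtain ⟨c, hc⟩ : ∃ c : ℝ, γ0 ^ c = C := ⟨Real.logb γ0 C, Real.rpow_logb hγ0 hγ1.ne hC0⟩
  have hc0 : c ≤ 0 := by
    by_contra hcon
    push Not at hcon
    have := Real.rpow_lt_one hγ0.le hγ1 hcon
    linarith
  have hck : 0 < c + k := by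
    by_contra hcon
    push Not at hcon
    have h1 := Real.one_le_rpow_of_pos_of_le_one_of_nonpos hγ0 hγ1.le hcon
    rw [Real.rpow_add hγ0, hc, Real.rpow_natCast] at h1
    have h2 := mul_lt_mul_of_pos_left hγk hC0
    rw [mul_inv_cancel₀ hC0.ne'] at h2
    linarith
  have hδ : 0 < (c + k) / 2 := by linarith
  have hstep : ∀ n, 1 - P n ≤ γ0 ^ ((1 + (c + k) / 2) ^ n : ℝ) →
      1 - P (n + 1) < γ0 ^ ((1 + (c + k) / 2) ^ (n + 1) : ℝ) := by
    intro n hn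
    have hm : 1 ≤ (1 + (c + k) / 2) ^ n := one_le_pow₀ (by linarith)
    rw [pow_succ]
    generalize (1 + (c + k) / 2) ^ n = m at *
    have hq0 : 0 ≤ 1 - P n := by linarith [hP1 n]
    have hpow : (1 - P n) ^ (k + 1) ≤ γ0 ^ (m * (k + 1)) := by
      have := pow_le_pow_left₀ hq0 hn (k + 1)
      rwa [← Real.rpow_natCast (γ0 ^ m), ← Real.rpow_mul hγ0.le, Nat.cast_add, Nat.cast_one] at this
    have hlt : C * (1 - P n) ^ (k + 1) < γ0 ^ (m * (1 + (c + k) / 2)) := by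
      calc C * (1 - P n) ^ (k + 1) ≤ C * γ0 ^ (m * (k + 1)) := by gcongr
        _ = γ0 ^ (c + m * (k + 1)) := by rw [Real.rpow_add hγ0, hc]
        _ < _ := by
          apply Real.rpow_lt_rpow_of_exponent_gt hγ0 hγ1
          nlinarith [mul_nonneg (sub_nonneg.2 hm) (by linarith : 0 ≤ (k - c) / 2)]
    have hle1 : γ0 ^ (m * (1 + (c + k) / 2)) ≤ 1 :=
      Real.rpow_le_one hγ0.le hγ1.le (by positivity)
    have hQ : 0 ≤ (1 - P n) ^ (k + 1) := by positivity
    have hr2 := hrec n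
    generalize (1 - P n) ^ (k + 1) = Q at *
    have hBQ : B * Q ≤ C * Q := by
      rw [hCe]
      nlinarith [mul_nonneg (sub_nonneg.2 hr') (mul_nonneg (by linarith : 0 ≤ B) hQ)]
    have hb := one_add_mul_le_pow (by linarith : -2 ≤ -(B * Q)) r
    rw [← sub_eq_add_neg] at hb
    rw [hCe] at hlt
    linarith
  have hall : ∀ n, 1 - P n ≤ γ0 ^ ((1 + (c + k) / 2) ^ n : ℝ) := by
    intro n
    induction n with
    | zero => simp; linarith
    | succ n ih => exact (hstep n ih).le
  refine ⟨(c + k) / 2, hδ, ?_⟩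
  intro n hn
  obtain ⟨j, rfl⟩ : ∃ j, n = j + 1 := ⟨n - 1, by omega⟩
  linarith [hstep j (hall j)]
end

section
/- Let $r \ge 1$, $k \ge 1$, and $A \ge k+1$ be integers, write $B = \binom{A}{k+1}$, and let $\gamma_0$ be a real number with $0 < \gamma_0 < (rB)^{-1/k}$. Let $P : \mathbb{N} \to \mathbb{R}$ be any sequence satisfying $P(0) \ge 1 - \gamma_0$, $P(n) \le 1$ for all $n$, and $P(n+1) \ge \big(1 - B\,(1-P(n))^{k+1}\big)^r$ for all $n \ge 0$. Then $P(n) \to 1$ as $n \to \infty$. -/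
open Real Filter

/-- Corollary of Lemma 1 of the paper: below the critical failure probability
`(r * B)^(-1/k)` with `B = choose A (k+1)`, the sparseness probabilities `P n`
tend to `1` as the concatenation level `n` goes to infinity. -/
theorem local_threshold_tendsto_one
    (r k A : ℕ) (hr : 1 ≤ r) (hk : 1 ≤ k) (hA : k + 1 ≤ A)
    (γ0 : ℝ) (hγ0 : 0 < γ0)
    (hthr : γ0 < ((r * A.choose (k + 1) : ℕ) : ℝ) ^ (-(1 / (k : ℝ))))
    (P : ℕ → ℝ)
    (hP0 : 1 - γ0 ≤ P 0)
    (hP1 : ∀ n, P n ≤ 1)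
    (hrec : ∀ n, (1 - (A.choose (k + 1) : ℝ) * (1 - P n) ^ (k + 1)) ^ r ≤ P (n + 1)) :
    Tendsto P atTop (nhds 1) := by
  have hB1 : 1 ≤ A.choose (k + 1) := Nat.choose_pos hA
  have hC1 : 1 ≤ r * A.choose (k + 1) := Nat.mul_pos hr hB1
  have hr' : (1 : ℝ) ≤ r := by exact_mod_cast hr
  have hB' : (1 : ℝ) ≤ (A.choose (k + 1) : ℝ) := by exact_mod_cast hB1
  have hC' : (1 : ℝ) ≤ ((r * A.choose (k + 1) : ℕ) : ℝ) := by exact_mod_cast hC1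
  have hk0 : (k : ℝ) ≠ 0 := by positivity
  have hg1 : γ0 ≤ 1 := by
    refine hthr.le.trans (Real.rpow_le_one_of_one_le_of_nonpos hC' ?_)
    have : (0 : ℝ) ≤ 1 / (k : ℝ) := by positivity
    linarith
  have hpow : γ0 ^ k < ((r * A.choose (k + 1) : ℕ) : ℝ)⁻¹ := by
    have h := pow_lt_pow_left₀ hthr hγ0.le (n := k) (by omega)
    rw [← Real.rpow_natCast (_ ^ _) k, ← Real.rpow_mul (by linarith)] at h
    have e : -(1 / (k : ℝ)) * k = -1 := by field_simp
    rwa [e, Real.rpow_neg_one] at h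
  push_cast at hC' hpow
  generalize (A.choose (k + 1) : ℝ) = B at *
  have hq1 : r * B * γ0 ^ k < 1 := by
    have hpos : 0 < r * B := by linarith
    have h := mul_lt_mul_of_pos_left hpow hpos
    rwa [mul_inv_cancel₀ hpos.ne'] at h
  have hq0 : 0 ≤ r * B * γ0 ^ k := by positivity
  set q : ℝ := r * B * γ0 ^ k with hq
  have key : ∀ n, 1 - P n ≤ γ0 * q ^ n := by
    intro n
    induction n with
    | zero => simp; linarith
    | succ n ih =>
      have hx0 : 0 ≤ 1 - P n := by linarith [hP1 n]
      have hxg : 1 - P n ≤ γ0 :=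
        ih.trans (mul_le_of_le_one_right hγ0.le (pow_le_one₀ hq0 hq1.le))
      have h := hrec n
      generalize 1 - P n = x at *
      have h1 : r * (B * x ^ (k + 1)) ≤ q * x := by
        have h2 : x ^ k ≤ γ0 ^ k := pow_le_pow_left₀ hx0 hxg k
        calc r * (B * x ^ (k + 1)) = r * B * x ^ k * x := by ring
          _ ≤ r * B * γ0 ^ k * x := by gcongr
      have hy0 : 0 ≤ B * x ^ (k + 1) := by positivity
      have hy1 : B * x ^ (k + 1) ≤ r * (B * x ^ (k + 1)) := le_mul_of_one_le_left hy0 hr'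
      have h3 : q * x ≤ x := mul_le_of_le_one_left hx0 hq1.le
      have hb := one_add_mul_le_pow (a := -(B * x ^ (k + 1))) (by linarith) r
      rw [← sub_eq_add_neg] at hb
      have h4 : q * x ≤ q * (γ0 * q ^ n) := mul_le_mul_of_nonneg_left ih hq0
      have h5 : γ0 * q ^ (n + 1) = q * (γ0 * q ^ n) := by ring
      rw [h5]
      linarith
  have hlim : Tendsto (fun n => 1 - γ0 * q ^ n) atTop (nhds 1) := by
    have := ((tendsto_pow_atTop_nhds_zero_of_lt_one hq0 hq1).const_mul γ0).const_sub 1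
    simpa using this
  exact tendsto_of_tendsto_of_tendsto_of_le_of_le hlim tendsto_const_nhds
    (fun n => by have := key n; simp only; linarith) hP1
end

section
/- Let $r \ge 1$, $k \ge 1$, and $A \ge k+1$ be integers, write $B = \binom{A}{k+1}$, and let $\gamma_0$ and $\delta$ be real numbers with $0 < \gamma_0 < 1$, $0 < \delta \le k$, and $r\,B\,\gamma_0^{k+1} < \gamma_0^{1+\delta}$. Let $n \ge 0$ be an integer and let $P, Q$ be real numbers with $1 - \gamma_0^{(1+\delta)^n} \le P \le 1$ and $Q \ge \big(1 - B\,(1-P)^{k+1}\big)^r$. Then $Q > 1 - \gamma_0^{(1+\delta)^{n+1}}$. -/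
open Real

/-- Induction step in the proof of Lemma 1 of the paper. -/
theorem induction_step_n_rectangle
    (r k A : ℕ) (hr : 1 ≤ r) (hk : 1 ≤ k) (hA : k + 1 ≤ A)
    (γ0 δ : ℝ) (hγ0 : 0 < γ0) (hγ0' : γ0 < 1) (hδ : 0 < δ) (hδk : δ ≤ (k : ℝ))
    (hbelow : (r : ℝ) * (A.choose (k + 1) : ℝ) * γ0 ^ (k + 1) < γ0 ^ ((1 : ℝ) + δ))
    (n : ℕ) (P Q : ℝ)
    (hPlow : 1 - γ0 ^ (((1 + δ) ^ n : ℝ)) ≤ P) (hPhigh : P ≤ 1)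
    (hQ : (1 - (A.choose (k + 1) : ℝ) * (1 - P) ^ (k + 1)) ^ r ≤ Q) :
    Q > 1 - γ0 ^ (((1 + δ) ^ (n + 1) : ℝ)) := by
  have hm : (1 : ℝ) ≤ (1 + δ) ^ n := one_le_pow₀ (by linarith)
  have hx0 : 0 < γ0 ^ ((1 + δ) ^ n : ℝ) := Real.rpow_pos_of_pos hγ0 _
  have hxγ : γ0 ^ ((1 + δ) ^ n : ℝ) ≤ γ0 := by
    have h := Real.rpow_le_rpow_of_exponent_ge hγ0 hγ0'.le hm
    rwa [Real.rpow_one] at h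
  have hpow : γ0 ^ ((1 + δ) ^ (n + 1) : ℝ) = (γ0 ^ ((1 + δ) ^ n : ℝ)) ^ (1 + δ) := by
    rw [← Real.rpow_mul hγ0.le, pow_succ]
  rw [hpow]
  generalize γ0 ^ ((1 + δ) ^ n : ℝ) = x at *
  have hsplit : ∀ y : ℝ, 0 < y → y ^ (1 + δ) = y ^ (δ - k) * y ^ (k + 1) := by
    intro y hy
    rw [← Real.rpow_natCast y (k + 1), ← Real.rpow_add hy]
    congr 1
    push_cast
    ring
  have h1 : (r : ℝ) * (A.choose (k + 1) : ℝ) < γ0 ^ (δ - k) := by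
    rw [hsplit γ0 hγ0] at hbelow
    exact lt_of_mul_lt_mul_right hbelow (by positivity)
  have h2 : γ0 ^ (δ - k) ≤ x ^ (δ - k) :=
    Real.rpow_le_rpow_of_nonpos hx0 hxγ (by linarith)
  have h3 : (r : ℝ) * (A.choose (k + 1) : ℝ) * x ^ (k + 1) < x ^ (1 + δ) := by
    rw [hsplit x hx0]
    exact mul_lt_mul_of_pos_right (h1.trans_le h2) (by positivity)
  have h4 : (1 - P) ^ (k + 1) ≤ x ^ (k + 1) :=
    pow_le_pow_left₀ (by linarith) (by linarith) _
  have hq0 : 0 ≤ (1 - P) ^ (k + 1) := pow_nonneg (by linarith) _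
  have h5 : (r : ℝ) * (A.choose (k + 1) : ℝ) * (1 - P) ^ (k + 1) < x ^ (1 + δ) :=
    (mul_le_mul_of_nonneg_left h4 (by positivity)).trans_lt h3
  have h6 : x ^ (1 + δ) ≤ 1 := Real.rpow_le_one hx0.le (by linarith) (by linarith)
  have hr' : (1 : ℝ) ≤ r := by exact_mod_cast hr
  have hb0 : 0 ≤ (A.choose (k + 1) : ℝ) * (1 - P) ^ (k + 1) := by positivity
  have h7 : (A.choose (k + 1) : ℝ) * (1 - P) ^ (k + 1) ≤ 1 := by nlinarith
  have h8 := one_add_mul_le_pow (a := -((A.choose (k + 1) : ℝ) * (1 - P) ^ (k + 1)))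
    (by linarith) r
  rw [← sub_eq_add_neg] at h8
  linarith
end
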